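/- For every integer d ≥ 2 and every f in ℂ[t, x_1, …, x_d], one has D1(f) = 0 if and only if there exists a natural number s such that t^s · f belongs to the ℂ-subalgebra of ℂ[t, x_1, …, x_d] generated by t, z_2, z_3, …, z_d. (In other words, the kernel of D1 equals ℂ[t, z_2, …, z_d][1/t] ∩ ℂ[t, x_1, …, x_d].) -/

import Mathlib

open MvPolynomial Finset
open scoped Fin.NatCast

/-- The derivation `D1 = t·∂/∂x₁ + 2x₁·∂/∂x₂ + ⋯ + d·x_{d−1}·∂/∂x_d` on
`ℂ[t, x₁, …, x_d]`, where the variable of index `0` is `t` and the variable of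
index `j ≥ 1` is `x_j`. -/
noncomputable def D1 (d : ℕ) :
    Derivation ℂ (MvPolynomial (Fin (d + 1)) ℂ) (MvPolynomial (Fin (d + 1)) ℂ) :=
  MvPolynomial.mkDerivation ℂ (fun i =>
    if (i : ℕ) = 0 then 0
    else ((i : ℕ) : ℂ) •
      MvPolynomial.X (⟨(i : ℕ) - 1, lt_of_le_of_lt (Nat.sub_le _ _) i.isLt⟩ : Fin (d + 1)))

/-- The semi-invariant
`z_i = Σ_{k=0}^{i−2} (−1)^k·binom(i,k)·x_{i−k}·x₁^k·t^{i−k−1} + (i−1)·(−1)^{i+1}·x₁^i`. -/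
noncomputable def Z (d i : ℕ) : MvPolynomial (Fin (d + 1)) ℂ :=
  (∑ k ∈ Finset.range (i - 1),
      MvPolynomial.C ((-1 : ℂ) ^ k * (i.choose k : ℂ)) *
        MvPolynomial.X (((i - k : ℕ) : Fin (d + 1))) *
        (MvPolynomial.X ((1 : ℕ) : Fin (d + 1))) ^ k *
        (MvPolynomial.X ((0 : ℕ) : Fin (d + 1))) ^ (i - k - 1)) +
    MvPolynomial.C (((i : ℂ) - 1) * (-1 : ℂ) ^ (i + 1)) *
      (MvPolynomial.X ((1 : ℕ) : Fin (d + 1))) ^ i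

lemma D1_X (d j : ℕ) (hj : j ≤ d) :
    D1 d (X ((j : ℕ) : Fin (d + 1))) = (j : MvPolynomial (Fin (d + 1)) ℂ) *
      X (((j - 1 : ℕ)) : Fin (d + 1)) := by
  have h1 : (((j : ℕ) : Fin (d + 1)) : ℕ) = j := Fin.val_cast_of_lt (by omega)
  have h2 : (((j - 1 : ℕ) : Fin (d + 1)) : ℕ) = j - 1 := Fin.val_cast_of_lt (by omega)
  unfold D1
  rw [mkDerivation_X]
  by_cases h0 : j = 0
  · subst h0; simp
  · rw [if_neg (by rw [h1]; exact h0)]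
    have : (⟨(((j : ℕ) : Fin (d + 1)) : ℕ) - 1,
        lt_of_le_of_lt (Nat.sub_le _ _) (Fin.isLt _)⟩ : Fin (d + 1)) =
        ((j - 1 : ℕ) : Fin (d + 1)) := by
      apply Fin.ext; rw [h2]; simp only [h1]
    rw [this, MvPolynomial.smul_eq_C_mul, h1, map_natCast]

lemma D1_t (d : ℕ) : D1 d (X ((0 : ℕ) : Fin (d + 1))) = 0 := by
  rw [D1_X d 0 (by omega)]; simp

lemma D1_x1 (d : ℕ) (hd : 2 ≤ d) :
    D1 d (X ((1 : ℕ) : Fin (d + 1))) = X ((0 : ℕ) : Fin (d + 1)) := by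
  rw [D1_X d 1 (by omega)]; simp

lemma t_mul_Z (d i : ℕ) (hi : 2 ≤ i) :
    X ((0 : ℕ) : Fin (d + 1)) * Z d i =
      ∑ k ∈ Finset.range (i + 1), (-1) ^ k * (i.choose k : MvPolynomial (Fin (d + 1)) ℂ) *
        X (((i - k : ℕ) : Fin (d + 1))) * X ((1 : ℕ) : Fin (d + 1)) ^ k *
        X ((0 : ℕ) : Fin (d + 1)) ^ (i - k) := by
  obtain ⟨n, rfl⟩ : ∃ n, i = n + 2 := ⟨i - 2, by omega⟩
  unfold Z
  rw [Finset.sum_range_succ, Finset.sum_range_succ, mul_add, Finset.mul_sum,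
    add_assoc (Finset.sum _ _)]
  congr 1
  · apply Finset.sum_congr rfl
    intro k hk
    have hk' : k < n + 1 := by simpa using hk
    obtain ⟨m, hm⟩ : ∃ m, n + 2 - k = m + 1 := ⟨n + 1 - k, by omega⟩
    simp only [hm, map_mul, map_pow, map_neg, map_one, map_natCast, Nat.add_sub_cancel, pow_succ]
    ring
  · have e1 : n + 2 - (n + 1) = 1 := by omega
    have e2 : (n + 2).choose (n + 1) = n + 2 := Nat.choose_succ_self_right (n + 1)
    rw [e1, e2, Nat.sub_self, Nat.choose_self]
    simp only [map_mul, map_pow, map_neg, map_one, map_natCast, map_sub]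
    push_cast
    ring

lemma D1_Z (d i : ℕ) (hd : 2 ≤ d) (hi : 2 ≤ i) (hid : i ≤ d) : D1 d (Z d i) = 0 := by
  have ht : (X ((0 : ℕ) : Fin (d + 1)) : MvPolynomial (Fin (d + 1)) ℂ) ≠ 0 := X_ne_zero _
  have key : D1 d (X ((0 : ℕ) : Fin (d + 1)) * Z d i) = 0 := by
    rw [t_mul_Z d i hi, map_sum]
    let T : ℕ → MvPolynomial (Fin (d + 1)) ℂ := fun k =>
      (-1) ^ k * (i.choose k : MvPolynomial (Fin (d + 1)) ℂ) * (k : MvPolynomial (Fin (d + 1)) ℂ) *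
        X (((i - k : ℕ) : Fin (d + 1))) * X ((1 : ℕ) : Fin (d + 1)) ^ (k - 1) *
        X ((0 : ℕ) : Fin (d + 1)) ^ (i - k + 1)
    have hT : ∀ k ∈ Finset.range (i + 1), D1 d ((-1) ^ k *
        (i.choose k : MvPolynomial (Fin (d + 1)) ℂ) *
        X (((i - k : ℕ) : Fin (d + 1))) * X ((1 : ℕ) : Fin (d + 1)) ^ k *
        X ((0 : ℕ) : Fin (d + 1)) ^ (i - k)) = T k - T (k + 1) := by
      intro k hk
      have hk' : k ≤ i := by simpa [Nat.lt_succ_iff] using hk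
      have hc : D1 d ((-1) ^ k * (i.choose k : MvPolynomial (Fin (d + 1)) ℂ)) = 0 := by
        have : ((-1) ^ k * (i.choose k : MvPolynomial (Fin (d + 1)) ℂ)) =
          algebraMap ℂ _ ((-1) ^ k * (i.choose k : ℂ)) := by simp
        rw [this, Derivation.map_algebraMap]
      have hch : (i.choose (k + 1) : MvPolynomial (Fin (d + 1)) ℂ) * ((k + 1 : ℕ) : _) =
          i.choose k * ((i - k : ℕ) : _) := by
        exact_mod_cast Nat.choose_succ_right_eq i k
      simp only [Derivation.leibniz, Derivation.leibniz_pow, hc, D1_t, D1_x1 d hd,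
        D1_X d (i - k) (by omega), smul_eq_mul, nsmul_eq_mul, T, mul_zero, add_zero, zero_add]
      have e1 : i - (k + 1) = i - k - 1 := by omega
      rw [e1, Nat.add_sub_cancel]
      have h3 : (-1) ^ (k + 1) * (i.choose (k + 1) : MvPolynomial (Fin (d + 1)) ℂ) *
          ((k + 1 : ℕ) : MvPolynomial (Fin (d + 1)) ℂ) =
          - ((-1) ^ k * (i.choose k * ((i - k : ℕ) : MvPolynomial (Fin (d + 1)) ℂ))) := by
        rw [← hch]; ring
      rw [h3]
      rcases Nat.eq_or_lt_of_le hk' with h | h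
      · subst h; simp; ring
      · obtain ⟨m, hm⟩ : ∃ m, i - k = m + 1 := ⟨i - k - 1, by omega⟩
        rw [hm, Nat.add_sub_cancel]
        ring
    rw [Finset.sum_congr rfl hT, Finset.sum_range_sub']
    simp [T]
  rw [Derivation.leibniz, D1_t] at key
  simpa [ht] using key

theorem ker_aux (d : ℕ) (hd : 2 ≤ d) (A : Subalgebra ℂ (MvPolynomial (Fin (d + 1)) ℂ))
    (hA : ∀ a ∈ A, D1 d a = 0) (htA : X ((0 : ℕ) : Fin (d + 1)) ∈ A)
    (hZ : ∀ i, 2 ≤ i → i ≤ d → Z d i ∈ A) (f : MvPolynomial (Fin (d + 1)) ℂ)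
    (hf : D1 d f = 0) : ∃ s : ℕ, X ((0 : ℕ) : Fin (d + 1)) ^ s * f ∈ A := by
  set t : MvPolynomial (Fin (d + 1)) ℂ := X ((0 : ℕ) : Fin (d + 1)) with ht
  set x : MvPolynomial (Fin (d + 1)) ℂ := X ((1 : ℕ) : Fin (d + 1)) with hx
  have ht0 : t ≠ 0 := X_ne_zero _
  have hD : ∀ P : Polynomial A, D1 d (Polynomial.aeval x P) =
      t * Polynomial.aeval x (Polynomial.derivative P) := by
    intro P
    induction P using Polynomial.induction_on' with
    | add p q hp hq => simp only [map_add, hp, hq, mul_add]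
    | monomial n a =>
      rw [Polynomial.derivative_monomial, Polynomial.aeval_monomial, Polynomial.aeval_monomial,
        Derivation.leibniz, Derivation.leibniz_pow, D1_x1 d hd]
      have : D1 d (algebraMap A (MvPolynomial (Fin (d + 1)) ℂ) a) = 0 := hA _ a.2
      rw [this]
      simp only [smul_eq_mul, nsmul_eq_mul, map_mul, map_natCast]
      ring
  have hconst : ∀ P : Polynomial A, Polynomial.derivative P = 0 → ∃ a, P = Polynomial.C a := by
    intro P hP
    exact ⟨_, Polynomial.eq_C_of_natDegree_eq_zero
      (Polynomial.derivative_eq_zero.mp hP)⟩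
  have hinj : ∀ n : ℕ, ∀ P : Polynomial A, P.natDegree ≤ n → Polynomial.aeval x P = 0 → P = 0 := by
    have hC : ∀ a : A, Polynomial.aeval x (Polynomial.C a) = 0 → Polynomial.C a = 0 := by
      intro a ha
      rw [Polynomial.aeval_C] at ha
      have : a = 0 := Subtype.ext ha
      rw [this, Polynomial.C_0]
    intro n
    induction n with
    | zero =>
      intro P hP h
      rw [Polynomial.eq_C_of_natDegree_le_zero hP] at h ⊢
      exact hC _ h
    | succ n ih =>
      intro P hP h
      have h1 := hD P
      rw [h, map_zero] at h1
      have h2 := (mul_eq_zero.mp h1.symm).resolve_left ht0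
      have h3 := ih _ ((Polynomial.natDegree_derivative_le P).trans (by omega)) h2
      obtain ⟨a, rfl⟩ := hconst P h3
      exact hC _ h
  let B : Subalgebra A (MvPolynomial (Fin (d + 1)) ℂ) :=
    (Polynomial.aeval (R := A) x).range
  have hAB : ∀ a ∈ A, a ∈ B := fun a ha => B.algebraMap_mem ⟨a, ha⟩
  have hxB : x ∈ B := ⟨Polynomial.X, by simp⟩
  have htB : t ∈ B := hAB _ htA
  have hCB : ∀ c : ℂ, C c ∈ B := fun c => hAB _ (A.algebraMap_mem c)
  have hX : ∀ j : ℕ, 1 ≤ j → j ≤ d → X ((j : ℕ) : Fin (d + 1)) * t ^ (j - 1) ∈ B := by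
    intro j
    induction j using Nat.strong_induction_on with
    | _ j ih =>
      intro h1 hjd
      rcases Nat.eq_or_lt_of_le h1 with h | h
      · subst h; simpa [hx] using hxB
      · obtain ⟨n, rfl⟩ : ∃ n, j = n + 2 := ⟨j - 2, by omega⟩
        have hz := hAB _ (hZ (n + 2) (by omega) hjd)
        have e : n + 2 - 1 = n + 1 := by omega
        unfold Z at hz
        rw [e, Finset.sum_range_succ'] at hz
        have hlast : C ((((n + 2 : ℕ) : ℂ) - 1) * (-1 : ℂ) ^ (n + 2 + 1)) * x ^ (n + 2) ∈ B :=
          B.mul_mem (hCB _) (B.pow_mem hxB _)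
        have hz2 := (B.sub_mem hz hlast)
        rw [add_sub_cancel_right] at hz2
        have hs := B.sub_mem hz2 (B.sum_mem (t := Finset.range n) (f := fun k =>
          C ((-1 : ℂ) ^ (k + 1) * ((n + 2).choose (k + 1) : ℂ)) *
            X (((n + 2 - (k + 1) : ℕ) : Fin (d + 1))) * x ^ (k + 1) *
            t ^ (n + 2 - (k + 1) - 1)) (fun k hk => by
              have hk' : k < n := by simpa using hk
              have := B.mul_mem (B.mul_mem (hCB ((-1 : ℂ) ^ (k + 1) * ((n + 2).choose (k + 1) : ℂ)))
                (B.pow_mem hxB (k + 1))) (ih (n + 2 - (k + 1)) (by omega) (by omega) (by omega))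
              convert this using 1
              ring))
        rw [add_sub_cancel_left] at hs
        simpa [ht] using hs
  have hall : ∀ g : MvPolynomial (Fin (d + 1)) ℂ, ∃ s : ℕ, t ^ s * g ∈ B := by
    intro g
    induction g using MvPolynomial.induction_on with
    | C a => exact ⟨0, by simpa using hCB a⟩
    | add p q hp hq =>
      obtain ⟨s, hs⟩ := hp
      obtain ⟨r, hr⟩ := hq
      refine ⟨s + r, ?_⟩
      have := B.add_mem (B.mul_mem (B.pow_mem htB r) hs) (B.mul_mem (B.pow_mem htB s) hr)
      convert this using 1
      ring
    | mul_X p i hp =>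
      obtain ⟨s, hs⟩ := hp
      have hi : (((i : ℕ) : ℕ) : Fin (d + 1)) = i := Fin.cast_val_eq_self i
      have : ∃ r, X i * t ^ r ∈ B := by
        by_cases h0 : (i : ℕ) = 0
        · refine ⟨0, ?_⟩
          rw [h0] at hi
          rw [← hi, pow_zero, mul_one]
          exact htB
        · have := hX i (by omega) (by omega)
          rw [hi] at this
          exact ⟨_, this⟩
      obtain ⟨r, hr⟩ := this
      refine ⟨s + r, ?_⟩
      have := B.mul_mem hs hr
      convert this using 1
      ring
  obtain ⟨s, P, hP⟩ := hall f
  refine ⟨s, ?_⟩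
  have hP' : Polynomial.aeval x P = t ^ s * f := hP
  have h1 := hD P
  rw [hP', Derivation.leibniz, Derivation.leibniz_pow, hf, D1_t] at h1
  simp only [smul_zero, add_zero] at h1
  have h2 := (mul_eq_zero.mp h1.symm).resolve_left ht0
  obtain ⟨a, rfl⟩ := hconst P (hinj _ _ le_rfl h2)
  rw [← hP', Polynomial.aeval_C]
  exact a.2

/-- `D1(f) = 0` iff some power of `t` times `f` lies in the `ℂ`-subalgebra generated by
`t, z₂, …, z_d`; i.e. the kernel of `D1` equals `ℂ[t, z₂, …, z_d][1/t] ∩ ℂ[t, x₁, …, x_d]`. -/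
theorem ker_D1_eq (d : ℕ) (hd : 2 ≤ d) (f : MvPolynomial (Fin (d + 1)) ℂ) :
    D1 d f = 0 ↔
      ∃ s : ℕ, (MvPolynomial.X ((0 : ℕ) : Fin (d + 1))) ^ s * f ∈
        Algebra.adjoin ℂ
          ({MvPolynomial.X ((0 : ℕ) : Fin (d + 1))} ∪
            {p : MvPolynomial (Fin (d + 1)) ℂ | ∃ i : ℕ, 2 ≤ i ∧ i ≤ d ∧ p = Z d i}) := by
  constructor
  · intro hf
    refine ker_aux d hd _ ?_ ?_ ?_ f hf
    · intro a ha
      induction ha using Algebra.adjoin_induction with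
      | mem p hp =>
        rcases hp with hp | ⟨i, h2, hi, rfl⟩
        · rw [Set.mem_singleton_iff.mp hp, D1_t]
        · exact D1_Z d i hd h2 hi
      | algebraMap r => exact Derivation.map_algebraMap _ _
      | add p q _ _ hp hq => rw [map_add, hp, hq, add_zero]
      | mul p q _ _ hp hq => rw [Derivation.leibniz, hp, hq, smul_zero, smul_zero, add_zero]
    · exact Algebra.subset_adjoin (Or.inl rfl)
    · intro i h2 hi
      exact Algebra.subset_adjoin (Or.inr ⟨i, h2, hi, rfl⟩)
  · rintro ⟨s, hs⟩
    have key : D1 d (X ((0 : ℕ) : Fin (d + 1)) ^ s * f) = 0 := by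
      generalize X ((0 : ℕ) : Fin (d + 1)) ^ s * f = g at hs ⊢
      induction hs using Algebra.adjoin_induction with
      | mem p hp =>
        rcases hp with hp | ⟨i, h2, hi, rfl⟩
        · rw [Set.mem_singleton_iff.mp hp, D1_t]
        · exact D1_Z d i hd h2 hi
      | algebraMap r => exact Derivation.map_algebraMap _ _
      | add p q _ _ hp hq => rw [map_add, hp, hq, add_zero]
      | mul p q _ _ hp hq => rw [Derivation.leibniz, hp, hq, smul_zero, smul_zero, add_zero]
    rw [Derivation.leibniz, Derivation.leibniz_pow, D1_t] at key
    simp only [smul_zero, mul_zero, add_zero, smul_eq_mul] at key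
    exact (mul_eq_zero.mp key).resolve_left (pow_ne_zero _ (X_ne_zero _))
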